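/- arXiv:0704.2048 — 2 statements merged into one kernel-verified Lean document; each statement's English description precedes it below -/
import Mathlib

section
/- For every n ≥ 0, the list 𝒟_n has exactly c_n entries and contains every 231-avoiding permutation of {1,…,n} exactly once. -/
/-- The number of positions in which two permutations (as lists) differ. -/
def ddist (σ τ : List ℕ) : ℕ :=
  ((σ.zip τ).filter fun p => p.1 != p.2).length

/-- `A 1 = 0` and `A i = c_0 + ⋯ + c_{i-2}` for `i > 1`, `c_m` the Catalan numbers. -/
def A (i : ℕ) : ℕ := ∑ m ∈ Finset.range (i - 1), catalan m

/-- `L^i`: the list `L` if `i` is odd, `L` reversed if `i` is even. -/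
def alt (L : List (List ℕ)) (i : ℕ) : List (List ℕ) :=
  if i % 2 = 1 then L else L.reverse

/-- `L(j)`: the `j`-th entry of the list `L` (entries numbered from 1). -/
def ent (L : List (List ℕ)) (j : ℕ) : List ℕ := L.getD (j - 1) []

/-- The recursively defined list `𝒟_n`: `𝒟_0` consists of the empty permutation, and
`𝒟_n` is the concatenation over `i = 1,…,n`, `j = 1,…,c_{i-1}`, `k = 1,…,c_{n-i}` of the
single permutation `[𝒟_{i-1}^{n+i-1}(j), n, 𝒟_{n-i}^{j+A(i)+1}(k) + (i-1)]`. -/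
def Dlist : ℕ → List (List ℕ)
  | 0 => [[]]
  | n + 1 =>
    (List.range (n + 1)).attach.flatMap fun i =>
      (List.range (catalan i.1)).flatMap fun j =>
        (List.range (catalan (n - i.1))).flatMap fun k =>
          [ent (alt (Dlist i.1) (n + 1 + i.1)) (j + 1) ++
            (n + 1) ::
              (ent (alt (Dlist (n - i.1)) (j + 1 + A (i.1 + 1) + 1)) (k + 1)).map
                (· + i.1)]
decreasing_by
  · have := i.2; simp only [List.mem_range] at this; omega
  · omega

/-- `π` is a permutation of `{1,…,n}` (written as the list of its values). -/
def IsPermOf (n : ℕ) (π : List ℕ) : Prop := π.Perm (List.range' 1 n)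

/-- `π` avoids the pattern 231: no indices `i < j < k` with `π(k) < π(i) < π(j)`. -/
def Avoids231 (π : List ℕ) : Prop :=
  ∀ i j k : ℕ, i < j → j < k → k < π.length →
    ¬(π.getD k 0 < π.getD i 0 ∧ π.getD i 0 < π.getD j 0)

theorem Dlist_succ (n : ℕ) : Dlist (n + 1) =
    (List.range (n + 1)).flatMap fun i =>
      (List.range (catalan i)).flatMap fun j =>
        (List.range (catalan (n - i))).flatMap fun k =>
          [ent (alt (Dlist i) (n + 1 + i)) (j + 1) ++
            (n + 1) ::
              (ent (alt (Dlist (n - i)) (j + 1 + A (i + 1) + 1)) (k + 1)).map (· + i)] := by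
  rw [Dlist]
  conv_rhs => rw [← List.attach_map_subtype_val (List.range (n + 1)), List.flatMap_map]

theorem length_alt (L : List (List ℕ)) (i : ℕ) : (alt L i).length = L.length := by
  unfold alt; split <;> simp

theorem mem_alt {L : List (List ℕ)} {i : ℕ} {π : List ℕ} : π ∈ alt L i ↔ π ∈ L := by
  unfold alt; split <;> simp

theorem nodup_alt {L : List (List ℕ)} {i : ℕ} : (alt L i).Nodup ↔ L.Nodup := by
  unfold alt; split <;> simp

theorem ent_succ_of_lt {L : List (List ℕ)} {j : ℕ} (h : j < L.length) :
    ent L (j + 1) = L[j] := by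
  simp [ent, h]

theorem ent_alt_mem {L : List (List ℕ)} {i j : ℕ} (h : j < L.length) :
    ent (alt L i) (j + 1) ∈ L := by
  rw [ent_succ_of_lt (by rwa [length_alt]), ← mem_alt (i := i)]
  exact List.getElem_mem _

theorem exists_ent_alt_eq {L : List (List ℕ)} {π : List ℕ} (i : ℕ) (h : π ∈ L) :
    ∃ j < L.length, ent (alt L i) (j + 1) = π := by
  obtain ⟨j, hj, rfl⟩ := List.getElem_of_mem (mem_alt (i := i).2 h)
  exact ⟨j, by rwa [length_alt] at hj, ent_succ_of_lt hj⟩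

theorem ent_alt_inj {L : List (List ℕ)} (hL : L.Nodup) {i j k : ℕ} (hj : j < L.length)
    (hk : k < L.length) (h : ent (alt L i) (j + 1) = ent (alt L i) (k + 1)) : j = k := by
  rw [ent_succ_of_lt (by rwa [length_alt]), ent_succ_of_lt (by rwa [length_alt])] at h
  exact (nodup_alt.2 hL).getElem_inj_iff.1 h

theorem IsPermOf.length_eq {n : ℕ} {π : List ℕ} (h : IsPermOf n π) : π.length = n := by
  simpa using List.Perm.length_eq h

theorem IsPermOf.le {n x : ℕ} {π : List ℕ} (h : IsPermOf n π) (hx : x ∈ π) : x ≤ n := by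
  have := (List.Perm.mem_iff h).1 hx
  simp only [List.mem_range'_1] at this
  omega

theorem IsPermOf.nodup {n : ℕ} {π : List ℕ} (h : IsPermOf n π) : π.Nodup :=
  (List.Perm.nodup_iff h).2 List.nodup_range'

/-- A permutation of `{1,…,n+1}` is assembled from a permutation of `{1,…,i}`, the maximum,
and a shifted permutation of `{1,…,n-i}`. -/
theorem IsPermOf.append_max_cons {n i : ℕ} (hi : i ≤ n) {σ τ : List ℕ} (hσ : IsPermOf i σ)
    (hτ : IsPermOf (n - i) τ) : IsPermOf (n + 1) (σ ++ (n + 1) :: τ.map (· + i)) := by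
  have hr : List.range' 1 (n + 1) =
      List.range' 1 i ++ (List.range' 1 (n - i)).map (· + i) ++ [n + 1] := by
    rw [List.range'_1_concat, add_comm 1 n]
    have : (List.range' 1 (n - i)).map (· + i) = List.range' (1 + i) (n - i) := by
      simp only [add_comm _ i, List.map_add_range']
    rw [this, List.range'_append_1, Nat.add_sub_cancel' hi]
  unfold IsPermOf
  rw [hr]
  refine List.perm_middle.trans ((List.perm_append_singleton _ _).symm.trans ?_)
  exact (List.Perm.append hσ (List.Perm.map _ hτ)).append_right _

/-- If all entries of `l` are below all entries of `r`, a permutation `l ++ r` of `{1,…,n}`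
splits into permutations of the two corresponding intervals. -/
theorem perm_range'_of_append_perm {n : ℕ} {l r : List ℕ}
    (h : (l ++ r).Perm (List.range' 1 n)) (hlt : ∀ x ∈ l, ∀ y ∈ r, x < y) :
    l.Perm (List.range' 1 l.length) ∧ r.Perm (List.range' (1 + l.length) (n - l.length)) := by
  have hn : l.length + r.length = n := by simpa using h.length_eq
  have hs : (l.insertionSort (· ≤ ·) ++ r.insertionSort (· ≤ ·)) = List.range' 1 n := by
    refine List.Perm.eq_of_pairwise (le := (· ≤ ·)) (fun a b _ _ => le_antisymm) ?_ ?_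
      (((List.perm_insertionSort _ l).append (List.perm_insertionSort _ r)).trans h)
    · rw [List.pairwise_append]
      refine ⟨List.pairwise_insertionSort _ l, List.pairwise_insertionSort _ r, ?_⟩
      intro x hx y hy
      exact (hlt x (by simpa using hx) y (by simpa using hy)).le
    · exact List.pairwise_le_range'
  rw [show n = l.length + (n - l.length) by omega, ← List.range'_append_1] at hs
  obtain ⟨h₁, h₂⟩ := List.append_inj hs (by simp)
  exact ⟨h₁ ▸ (List.perm_insertionSort _ l).symm, h₂ ▸ (List.perm_insertionSort _ r).symm⟩

theorem Avoids231.of_append_left {l r : List ℕ} (h : Avoids231 (l ++ r)) : Avoids231 l := by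
  intro i j k hij hjk hk
  have := h i j k hij hjk (by simp; omega)
  rwa [List.getD_append _ _ _ _ hk, List.getD_append _ _ _ _ (hjk.trans hk),
    List.getD_append _ _ _ _ (hij.trans (hjk.trans hk))] at this

theorem Avoids231.of_append_right {l r : List ℕ} (h : Avoids231 (l ++ r)) : Avoids231 r := by
  intro i j k hij hjk hk
  have := h (l.length + i) (l.length + j) (l.length + k) (by omega) (by omega) (by simp; omega)
  simpa only [List.getD_append_right _ _ _ _ (Nat.le_add_right _ _), Nat.add_sub_cancel_left]
    using this

theorem Avoids231.of_map_add {l : List ℕ} {m : ℕ} (h : Avoids231 (l.map (· + m))) :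
    Avoids231 l := by
  intro i j k hij hjk hk
  have := h i j k hij hjk (by simpa)
  have hj := hjk.trans hk
  have hi := hij.trans hj
  simpa [hk, hj, hi] using this

theorem Avoids231.le_of_append_cons {l r : List ℕ} {m x y : ℕ} (h : Avoids231 (l ++ m :: r))
    (hx : x ∈ l) (hy : y ∈ r) (hxm : x < m) : x ≤ y := by
  obtain ⟨a, ha, rfl⟩ := List.getElem_of_mem hx
  obtain ⟨b, hb, rfl⟩ := List.getElem_of_mem hy
  have := h a l.length (l.length + (b + 1)) ha (by omega) (by simp; omega)
  rw [List.getD_append _ _ _ _ ha, List.getD_append_right _ _ _ _ le_rfl,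
    List.getD_append_right _ _ _ _ (by omega)] at this
  simp [ha, hb] at this
  by_contra! hlt
  exact absurd (this hlt) (by omega)

/-- Every nonempty 231-avoiding permutation splits at its maximum. -/
theorem exists_eq_append_max_cons {n : ℕ} {π : List ℕ} (hπ : IsPermOf (n + 1) π)
    (ha : Avoids231 π) : ∃ i ≤ n, ∃ σ τ : List ℕ, IsPermOf i σ ∧ Avoids231 σ ∧
      IsPermOf (n - i) τ ∧ Avoids231 τ ∧ π = σ ++ (n + 1) :: τ.map (· + i) := by
  obtain ⟨l, r, rfl⟩ := List.append_of_mem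
    ((List.Perm.mem_iff hπ).2 (by simp) : n + 1 ∈ π)
  have hnd := hπ.nodup
  have hp : (l ++ r).Perm (List.range' 1 n) := by
    have h : (l ++ (n + 1) :: r).Perm (List.range' 1 (n + 1)) := hπ
    rw [List.range'_1_concat, add_comm 1 n] at h
    exact (List.perm_cons _).1
      (List.perm_middle.symm.trans (h.trans (List.perm_append_singleton _ _)))
  have hlt : ∀ x ∈ l, ∀ y ∈ r, x < y := by
    intro x hx y hy
    have hxn := (hp.mem_iff (a := x)).1 (by simp [hx])
    simp only [List.mem_range'_1] at hxn
    have hle := ha.le_of_append_cons hx hy (by omega)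
    have hne := (List.nodup_append.1 hnd).2.2 x hx y (by simp [hy])
    omega
  obtain ⟨hl, hr⟩ := perm_range'_of_append_perm hp hlt
  have hlen : l.length + r.length = n := by simpa using hp.length_eq
  have hmap : r = (r.map (· - l.length)).map (· + l.length) := by
    rw [List.map_map]
    refine ((List.map_congr_left fun y hy => ?_).trans (List.map_id r)).symm
    have := (hr.mem_iff (a := y)).1 hy
    simp only [List.mem_range'_1] at this
    simp only [Function.comp_apply, id_eq]
    omega
  have har : Avoids231 ((r.map (· - l.length)).map (· + l.length)) := by
    rw [← hmap]
    exact Avoids231.of_append_right (l := l ++ [n + 1]) (by simpa using ha)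
  refine ⟨l.length, by omega, l, r.map (· - l.length), hl, ha.of_append_left, ?_,
    har.of_map_add, by rw [← hmap]⟩
  have := hr.map (· - l.length)
  rwa [List.map_sub_range' (by omega), Nat.add_sub_cancel] at this

theorem mem_Dlist_succ {n : ℕ} {π : List ℕ} : π ∈ Dlist (n + 1) ↔
    ∃ i < n + 1, ∃ j < catalan i, ∃ k < catalan (n - i),
      π = ent (alt (Dlist i) (n + 1 + i)) (j + 1) ++ (n + 1) ::
        (ent (alt (Dlist (n - i)) (j + 1 + A (i + 1) + 1)) (k + 1)).map (· + i) := by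
  simp [Dlist_succ]

theorem length_Dlist (n : ℕ) : (Dlist n).length = catalan n := by
  cases n with
  | zero => simp [Dlist]
  | succ n =>
    rw [Dlist_succ, catalan_succ', Finset.Nat.sum_antidiagonal_eq_sum_range_succ_mk]
    simp [List.length_flatMap]
    rfl

theorem isPermOf_of_mem_Dlist {n : ℕ} {π : List ℕ} (h : π ∈ Dlist n) : IsPermOf n π := by
  induction n using Nat.strong_induction_on generalizing π with
  | _ n ih =>
    cases n with
    | zero => simp_all [Dlist, IsPermOf]
    | succ n =>
      obtain ⟨i, hi, j, hj, k, hk, rfl⟩ := mem_Dlist_succ.1 h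
      exact IsPermOf.append_max_cons (by omega)
        (ih i hi (ent_alt_mem (by rwa [length_Dlist])))
        (ih (n - i) (by omega) (ent_alt_mem (by rwa [length_Dlist])))

theorem mem_Dlist {n : ℕ} {π : List ℕ} (hπ : IsPermOf n π) (ha : Avoids231 π) :
    π ∈ Dlist n := by
  induction n using Nat.strong_induction_on generalizing π with
  | _ n ih =>
    cases n with
    | zero => simp_all [Dlist, IsPermOf]
    | succ n =>
      obtain ⟨i, hi, σ, τ, hσ, haσ, hτ, haτ, rfl⟩ := exists_eq_append_max_cons hπ ha
      obtain ⟨j, hj, hjσ⟩ := exists_ent_alt_eq (n + 1 + i) (ih i (by omega) hσ haσ)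
      obtain ⟨k, hk, hkτ⟩ :=
        exists_ent_alt_eq (j + 1 + A (i + 1) + 1) (ih (n - i) (by omega) hτ haτ)
      rw [length_Dlist] at hj hk
      exact mem_Dlist_succ.2 ⟨i, by omega, j, hj, k, hk, by rw [hjσ, hkτ]⟩

/-- A splitting of a permutation at its maximum is unique. -/
theorem append_max_cons_inj {n i i' : ℕ} (hi : i ≤ n) (hi' : i' ≤ n) {σ σ' τ τ' : List ℕ}
    (hσ : IsPermOf i σ) (hσ' : IsPermOf i' σ')
    (h : σ ++ (n + 1) :: τ.map (· + i) = σ' ++ (n + 1) :: τ'.map (· + i')) :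
    i = i' ∧ σ = σ' ∧ τ = τ' := by
  have hn : n + 1 ∉ σ := fun hm => absurd (hσ.le hm) (by omega)
  have hn' : n + 1 ∉ σ' := fun hm => absurd (hσ'.le hm) (by omega)
  have hii : i = i' := by
    have := congrArg (List.idxOf (n + 1)) h
    rw [List.idxOf_append_of_notMem hn, List.idxOf_append_of_notMem hn'] at this
    simpa [hσ.length_eq, hσ'.length_eq] using this
  subst hii
  obtain ⟨h₁, h₂⟩ := List.append_inj h (by rw [hσ.length_eq, hσ'.length_eq])
  refine ⟨rfl, h₁, ?_⟩
  exact List.map_injective_iff.2 (add_left_injective i) (List.cons.inj h₂).2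

theorem nodup_Dlist (n : ℕ) : (Dlist n).Nodup := by
  induction n using Nat.strong_induction_on with
  | _ n ih =>
    cases n with
    | zero => simp [Dlist]
    | succ n =>
      have perm : ∀ {m s j : ℕ}, j < catalan m → IsPermOf m (ent (alt (Dlist m) s) (j + 1)) :=
        fun hj => isPermOf_of_mem_Dlist (ent_alt_mem (by rwa [length_Dlist]))
      have inj : ∀ {m s j k : ℕ}, m < n + 1 → j < catalan m → k < catalan m →
          ent (alt (Dlist m) s) (j + 1) = ent (alt (Dlist m) s) (k + 1) → j = k :=
        fun hm hj hk => ent_alt_inj (ih _ hm) (by rwa [length_Dlist]) (by rwa [length_Dlist])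
      rw [Dlist_succ]
      refine List.nodup_flatMap.2 ⟨fun i hi => List.nodup_flatMap.2 ⟨fun j hj =>
        List.nodup_flatMap.2 ⟨fun k _ => List.nodup_singleton _, ?_⟩, ?_⟩, ?_⟩
      all_goals
        refine List.Nodup.pairwise_of_forall_ne List.nodup_range fun a ha b hb hab π hπ hπ' => ?_
        simp only [List.mem_range, List.mem_flatMap, List.mem_singleton] at *
      · obtain ⟨-, -, h⟩ := append_max_cons_inj (by omega) (by omega) (perm hj) (perm hj)
          (hπ.symm.trans hπ')
        exact hab (inj (by omega) ha hb h)
      · obtain ⟨k, hk, rfl⟩ := hπ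
        obtain ⟨k', hk', h⟩ := hπ'
        obtain ⟨-, h, -⟩ := append_max_cons_inj (by omega) (by omega) (perm ha) (perm hb) h
        exact hab (inj hi ha hb h)
      · obtain ⟨j, hj, k, hk, rfl⟩ := hπ
        obtain ⟨j', hj', k', hk', h⟩ := hπ'
        exact hab (append_max_cons_inj (by omega) (by omega) (perm hj) (perm hj') h).1

/-- The list `𝒟_n` has exactly `c_n` entries and contains every 231-avoiding
permutation of `{1,…,n}` exactly once. -/
theorem Dlist_length_and_contains_each_avoider_once :
    ∀ n : ℕ, (Dlist n).length = catalan n ∧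
      ∀ π : List ℕ, IsPermOf n π → Avoids231 π → (Dlist n).count π = 1 := by
  exact fun n => ⟨length_Dlist n, fun π hπ ha =>
    List.count_eq_one_of_mem (nodup_Dlist n) (mem_Dlist hπ ha)⟩
end

section
/- Let T be a regular set of patterns. Then any two consecutive permutations in the list 𝒞_n(T) differ in at most five positions. -/
/-- The lists `s` and `τ` have the same length and are order-isomorphic. -/
def OrderIsomorphic (s τ : List ℕ) : Prop :=
  s.length = τ.length ∧ ∀ i j : ℕ, i < s.length → j < s.length →
    (s.getD i 0 < s.getD j 0 ↔ τ.getD i 0 < τ.getD j 0)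

/-- `π` avoids the pattern `τ`: no subsequence of `π` is order-isomorphic to `τ`. -/
def Avoids (π τ : List ℕ) : Prop := ¬∃ s : List ℕ, s.Sublist π ∧ OrderIsomorphic s τ

/-- `π` avoids every pattern in the set `T`. -/
def AvoidsAll (T : Set (List ℕ)) (π : List ℕ) : Prop := ∀ τ ∈ T, Avoids π τ

/-- Insert the value `n+1` into site `i` of a permutation `π` of `{1,…,n}`; sites are
numbered from right to left from `1` to `n+1`, so the new value gets exactly `i-1`
entries of `π` to its right. -/
def insertSite (π : List ℕ) (i : ℕ) : List ℕ :=
  π.take (π.length + 1 - i) ++ (π.length + 1) :: π.drop (π.length + 1 - i)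

/-- Site `i` of `π` is active with respect to the forbidden patterns `T`: inserting the
next-largest value into site `i` produces a permutation avoiding all patterns of `T`. -/
def ActiveSite (T : Set (List ℕ)) (π : List ℕ) (i : ℕ) : Prop :=
  1 ≤ i ∧ i ≤ π.length + 1 ∧ AvoidsAll T (insertSite π i)

/-- The number of active sites of `π` with respect to `T`. -/
noncomputable def numActive (T : Set (List ℕ)) (π : List ℕ) : ℕ :=
  {i : ℕ | ActiveSite T π i}.ncard

/-- A set of patterns `T` is regular if every `π ∈ 𝔖_n(T)` (for every `n ≥ 1`) has at
least two active sites, its active sites are right justified, and the number of active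
sites of the permutation obtained by inserting `n+1` into the `i`-th active site
depends only on `i` and the number of active sites of `π`, not on `π` itself. -/
def Regular (T : Set (List ℕ)) : Prop :=
  (∀ n : ℕ, 1 ≤ n → ∀ π : List ℕ, IsPermOf n π → AvoidsAll T π →
    2 ≤ numActive T π ∧
      ∀ i j : ℕ, ActiveSite T π i → 1 ≤ j → j ≤ i → ActiveSite T π j) ∧
  (∀ n m : ℕ, ∀ π ρ : List ℕ, 1 ≤ n → 1 ≤ m → IsPermOf n π → IsPermOf m ρ →
    AvoidsAll T π → AvoidsAll T ρ → numActive T π = numActive T ρ →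
    ∀ i : ℕ, 1 ≤ i → i ≤ numActive T π →
      numActive T (insertSite π i) = numActive T (insertSite ρ i))

/-- The unimodal sequence `L_k`: `1,3,5,…,k,(k-1),(k-3),…,4,2` when `k` is odd and
`1,3,5,…,(k-1),k,(k-2),…,4,2` when `k` is even (the odd numbers in `{1,…,k}` in
increasing order followed by the even ones in decreasing order). -/
def Lseq (k : ℕ) : List ℕ :=
  ((List.range (k + 1)).filter fun x => x % 2 == 1) ++
    (((List.range (k + 1)).filter fun x => x % 2 == 0 && x != 0).reverse)

/-- The list of successors `φ(π^1)` of the upward-directed permutation `π^1` (directions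
are recorded as a `Bool`, `true` = up, `false` = down): its `j`-th element is obtained
from `π` by inserting the next-largest value into the `L_k(j)`-th active site (which is
site `L_k(j)`, since active sites are right justified), where `k` is the number of
active sites of `π`; the first successor is directed up and all others down. -/
noncomputable def phiUp (T : Set (List ℕ)) (π : List ℕ) : List (List ℕ × Bool) :=
  match (Lseq (numActive T π)).map (fun i => insertSite π i) with
  | [] => []
  | a :: rest => (a, true) :: rest.map fun x => (x, false)

/-- The list of successors of a directed permutation: `φ(π^0)` is `φ(π^1)` reversed
with every direction flipped. -/
noncomputable def phi (T : Set (List ℕ)) (p : List ℕ × Bool) : List (List ℕ × Bool) :=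
  if p.2 then phiUp T p.1
  else ((phiUp T p.1).map fun q => (q.1, !q.2)).reverse

/-- The list `𝒞_n(T)` of directed permutations: `𝒞_1 = ((1)^1)` and `𝒞_n` is the
concatenation of the lists of successors of the entries of `𝒞_{n-1}`. -/
noncomputable def Cl (T : Set (List ℕ)) : ℕ → List (List ℕ × Bool)
  | 0 => []
  | 1 => [([1], true)]
  | n + 2 => (Cl T (n + 1)).flatMap (phi T)

/-! ### The distance `ddist` -/

theorem ddist_cons_cons (x y : ℕ) (s t : List ℕ) :
    ddist (x :: s) (y :: t) = ddist s t + if x = y then 0 else 1 := by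
  by_cases h : x = y <;> simp [ddist, h]

theorem ddist_self (s : List ℕ) : ddist s s = 0 := by
  induction s with
  | nil => rfl
  | cons x s ih => simp [ddist_cons_cons, ih]

theorem ddist_comm (s t : List ℕ) : ddist s t = ddist t s := by
  induction s generalizing t with
  | nil => cases t <;> rfl
  | cons x s ih =>
    cases t with
    | nil => rfl
    | cons y t => simp [ddist_cons_cons, ih t, eq_comm]

theorem ddist_append {s t : List ℕ} (h : s.length = t.length) (u v : List ℕ) :
    ddist (s ++ u) (t ++ v) = ddist s t + ddist u v := by
  simp [ddist, List.zip_append h]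

theorem ddist_le_length (s t : List ℕ) : ddist s t ≤ s.length :=
  (List.length_filter_le _ _).trans (by simp)

theorem ddist_triangle {s t u : List ℕ} (hst : s.length = t.length) :
    ddist s u ≤ ddist s t + ddist t u := by
  induction s generalizing t u with
  | nil => simp [ddist]
  | cons x s ih =>
    obtain _ | ⟨y, t⟩ := t
    · simp at hst
    obtain _ | ⟨z, u⟩ := u
    · simp [ddist]
    have := ih (t := t) (u := u) (by simpa using hst)
    simp only [ddist_cons_cons]
    split_ifs <;> grind

/-! ### Inserting the next-largest value -/

theorem length_insertSite (π : List ℕ) (i : ℕ) : (insertSite π i).length = π.length + 1 := by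
  simp [insertSite]; omega

theorem sublist_insertSite (π : List ℕ) (i : ℕ) : π.Sublist (insertSite π i) := by
  conv_lhs => rw [← List.take_append_drop (π.length + 1 - i) π]
  exact (List.Sublist.refl _).append (List.sublist_cons_self _ _)

theorem IsPermOf.insertSite {n : ℕ} {π : List ℕ} (h : IsPermOf n π) (i : ℕ) :
    IsPermOf (n + 1) (insertSite π i) := by
  have h1 : (_root_.insertSite π i).Perm ((π.length + 1) :: π) :=
    List.perm_middle.trans (by rw [List.take_append_drop])
  refine h1.trans ?_
  rw [h.length_eq, List.range'_1_concat, add_comm n 1]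
  exact (List.Perm.cons _ h).trans (List.perm_append_singleton _ _).symm

theorem ddist_insertSite_insertSite {a b : List ℕ} (h : a.length = b.length) (i : ℕ) :
    ddist (insertSite a i) (insertSite b i) = ddist a b := by
  conv_rhs => rw [← List.take_append_drop (a.length + 1 - i) a,
    ← List.take_append_drop (a.length + 1 - i) b]
  rw [insertSite, insertSite, ← h, ddist_append (by simp [h]), ddist_append (by simp [h]),
    ddist_cons_cons]
  simp

theorem ddist_insertSite_le {i j d : ℕ} (π : List ℕ) (hij : i ≤ j) (hjd : j ≤ i + d) :
    ddist (insertSite π i) (insertSite π j) ≤ d + 1 := by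
  obtain ⟨e, he, hed⟩ : ∃ e, π.length + 1 - i = π.length + 1 - j + e ∧ e ≤ d :=
    ⟨π.length + 1 - i - (π.length + 1 - j), by omega, by omega⟩
  simp only [insertSite, he]
  set p := π.length + 1 - j
  have h1 : π.take (p + e) = π.take p ++ (π.drop p).take e := List.take_add
  have h2 : π.drop p = (π.drop p).take e ++ π.drop (p + e) := by
    rw [← List.drop_drop, List.take_append_drop]
  rw [h1, List.append_assoc, ddist_append rfl, ddist_self, zero_add]
  conv_lhs => arg 2; rw [h2]
  rw [← List.singleton_append, ← List.append_assoc, ← List.cons_append,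
    ddist_append (by simp), ddist_self, add_zero]
  refine (ddist_le_length _ _).trans ?_
  simp; omega

theorem ddist_insertSite_le_of_dist {i j d : ℕ} (π : List ℕ) (hij : i ≤ j + d) (hji : j ≤ i + d) :
    ddist (insertSite π i) (insertSite π j) ≤ d + 1 := by
  obtain h | h := le_total i j
  · exact ddist_insertSite_le π h hji
  · rw [ddist_comm]
    exact ddist_insertSite_le π h hij

theorem ddist_insertSite_adjacent {a b : List ℕ} (h : a.length = b.length) {i j : ℕ}
    (hij : i ≤ j + 1) (hji : j ≤ i + 1) :
    ddist (insertSite a i) (insertSite b j) ≤ ddist a b + 2 := by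
  have h1 := ddist_triangle (s := insertSite a i) (t := insertSite b i) (u := insertSite b j)
    (by simp [length_insertSite, h])
  have h2 := ddist_insertSite_insertSite h i
  have h3 := ddist_insertSite_le_of_dist b hij hji
  omega

/-! ### The unimodal sequence `Lseq` -/

theorem filter_odd_range (k : ℕ) :
    ((List.range (k + 1)).filter fun x => x % 2 == 1) =
      (List.range ((k + 1) / 2)).map fun i => 2 * i + 1 := by
  induction k with
  | zero => rfl
  | succ k ih =>
    rw [List.range_succ, List.filter_append, ih]
    obtain h | h := Nat.mod_two_eq_zero_or_one (k + 1)
    · rw [show (k + 1 + 1) / 2 = (k + 1) / 2 by omega]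
      simp [h]
    · rw [show (k + 1 + 1) / 2 = (k + 1) / 2 + 1 by omega, List.range_succ, List.map_append]
      simp [h]; omega

theorem filter_even_range (k : ℕ) :
    ((List.range (k + 1)).filter fun x => x % 2 == 0 && x != 0) =
      (List.range (k / 2)).map fun i => 2 * i + 2 := by
  induction k with
  | zero => rfl
  | succ k ih =>
    rw [List.range_succ, List.filter_append, ih]
    obtain h | h := Nat.mod_two_eq_zero_or_one (k + 1)
    · rw [show (k + 1) / 2 = k / 2 + 1 by omega, List.range_succ, List.map_append]
      simp [h]; omega
    · rw [show (k + 1) / 2 = k / 2 by omega]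
      simp [h]

theorem Lseq_eq (k : ℕ) :
    Lseq k = (List.range ((k + 1) / 2)).map (fun i => 2 * i + 1) ++
      ((List.range (k / 2)).map fun i => 2 * i + 2).reverse := by
  rw [Lseq, filter_odd_range, filter_even_range]

theorem mem_Lseq {k i : ℕ} (h : i ∈ Lseq k) : 1 ≤ i ∧ i ≤ k := by
  simp only [Lseq_eq, List.mem_append, List.mem_reverse, List.mem_map, List.mem_range] at h
  obtain ⟨j, hj, rfl⟩ | ⟨j, hj, rfl⟩ := h <;> omega

theorem Lseq_eq_cons_append {k : ℕ} (hk : 2 ≤ k) : ∃ M, Lseq k = 1 :: (M ++ [2]) := by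
  obtain ⟨m, hm⟩ : ∃ m, (k + 1) / 2 = m + 1 := ⟨(k + 1) / 2 - 1, by omega⟩
  obtain ⟨l, hl⟩ : ∃ l, k / 2 = l + 1 := ⟨k / 2 - 1, by omega⟩
  rw [Lseq_eq, hm, hl, List.range_succ_eq_map, List.range_succ_eq_map]
  simp only [List.map_cons, List.reverse_cons, List.cons_append, ← List.append_assoc]
  exact ⟨_, rfl⟩

theorem isChain_Lseq (k : ℕ) : (Lseq k).IsChain fun i j => i ≤ j + 2 ∧ j ≤ i + 2 := by
  rw [Lseq_eq, List.isChain_append, List.isChain_reverse, List.isChain_map, List.isChain_map,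
    List.isChain_range, List.isChain_range]
  refine ⟨by omega, by omega, ?_⟩
  simp only [List.head?_reverse, List.getLast?_map, List.getLast?_range]
  intro x hx y hy
  split_ifs at hx hy <;> simp at hx hy
  omega

/-! ### Active sites -/

theorem AvoidsAll.of_sublist {T : Set (List ℕ)} {s π : List ℕ} (hs : s.Sublist π)
    (h : AvoidsAll T π) : AvoidsAll T s :=
  fun τ hτ ⟨u, hu, hiso⟩ => h τ hτ ⟨u, hu.trans hs, hiso⟩

theorem numActive_eq_zero {T : Set (List ℕ)} {π : List ℕ} (h : ¬AvoidsAll T π) :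
    numActive T π = 0 := by
  have : {i : ℕ | ActiveSite T π i} = ∅ := by
    ext i
    simpa using fun hi : ActiveSite T π i => h (hi.2.2.of_sublist (sublist_insertSite π i))
  rw [numActive, this, Set.ncard_empty]

theorem Regular.activeSite {T : Set (List ℕ)} (hT : Regular T) {n : ℕ} (hn : 1 ≤ n) {π : List ℕ}
    (hπ : IsPermOf n π) (ha : AvoidsAll T π) {i : ℕ} (hi : 1 ≤ i) (hik : i ≤ numActive T π) :
    ActiveSite T π i := by
  by_contra hcon
  have hsub : {j : ℕ | ActiveSite T π j} ⊆ ↑(Finset.Icc 1 (i - 1)) := by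
    intro j hj
    have : j < i := by
      by_contra! hij
      exact hcon ((hT.1 n hn π hπ ha).2 j i hj hi hij)
    have := hj.1
    simp only [Finset.coe_Icc, Set.mem_Icc]
    omega
  have hcard := Set.ncard_le_ncard hsub (Finset.finite_toSet _)
  rw [Set.ncard_coe_finset, Nat.card_Icc] at hcard
  rw [numActive] at hik
  omega

/-! ### Lists of successors -/

theorem map_fst_phiUp (T : Set (List ℕ)) (π : List ℕ) :
    (phiUp T π).map Prod.fst = (Lseq (numActive T π)).map (insertSite π) := by
  unfold phiUp
  split <;> rename_i h <;> rw [h] <;> simp [Function.comp_def]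

theorem fst_eq_of_mem_phi {T : Set (List ℕ)} {p x : List ℕ × Bool} (h : x ∈ phi T p) :
    ∃ i ∈ Lseq (numActive T p.1), insertSite p.1 i = x.1 := by
  have h1 : x.1 ∈ (phiUp T p.1).map Prod.fst := by
    rw [phi] at h
    split_ifs at h
    · exact List.mem_map_of_mem h
    · simp only [List.mem_reverse, List.mem_map] at h
      obtain ⟨q, hq, rfl⟩ := h
      exact List.mem_map.2 ⟨q, hq, rfl⟩
  rwa [map_fst_phiUp, List.mem_map] at h1

theorem isChain_phi (T : Set (List ℕ)) (p : List ℕ × Bool) :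
    (phi T p).IsChain fun x y => ddist x.1 y.1 ≤ 3 := by
  have h : (phiUp T p.1).IsChain fun x y => ddist x.1 y.1 ≤ 3 := by
    rw [← List.isChain_map (R := fun x y => ddist x y ≤ 3), map_fst_phiUp, List.isChain_map]
    exact (isChain_Lseq _).imp fun i j hij => ddist_insertSite_le_of_dist _ hij.1 hij.2
  rw [phi]
  split_ifs
  · exact h
  · rw [List.isChain_reverse, List.isChain_map]
    exact h.imp fun x y hxy => by simpa only [ddist_comm] using hxy

theorem phi_ends {T : Set (List ℕ)} {p : List ℕ × Bool} (h : 2 ≤ numActive T p.1) :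
    (phi T p).head? = some (insertSite p.1 (if p.2 then 1 else 2), true) ∧
      (phi T p).getLast? = some (insertSite p.1 (if p.2 then 2 else 1), false) := by
  obtain ⟨M, hM⟩ := Lseq_eq_cons_append h
  have hup : phiUp T p.1 = (insertSite p.1 1, true) ::
      (M.map (fun i => (insertSite p.1 i, false)) ++ [(insertSite p.1 2, false)]) := by
    simp [phiUp, hM, Function.comp_def]
  rw [phi, hup]
  cases p.2 <;> simp [List.getLast?_cons]

/-- The relation between consecutive entries of `Cl`. -/
def Close (x y : List ℕ × Bool) : Prop :=
  ddist x.1 y.1 ≤ 3 ∨ ddist x.1 y.1 ≤ 5 ∧ x.2 = false ∧ y.2 = true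

theorem Close.ends {T : Set (List ℕ)} {p q : List ℕ × Bool} (hpq : Close p q)
    (hlen : p.1.length = q.1.length) (hp : 2 ≤ numActive T p.1) (hq : 2 ≤ numActive T q.1) :
    ∀ x ∈ (phi T p).getLast?, ∀ y ∈ (phi T q).head?, Close x y := by
  rw [(phi_ends hp).2, (phi_ends hq).1]
  simp only [Option.mem_some_iff]
  rintro x rfl y rfl
  refine Or.inr ⟨?_, rfl, rfl⟩
  obtain h | ⟨h, h1, h2⟩ := hpq
  · refine (ddist_insertSite_adjacent hlen ?_ ?_).trans (Nat.add_le_add_right h 2) <;>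
      split_ifs <;> omega
  · simpa [h1, h2, ddist_insertSite_insertSite hlen] using h

/-! ### The lists `Cl` -/

theorem Cl_eq_nil {T : Set (List ℕ)} (h : ¬AvoidsAll T [1]) (n : ℕ) : Cl T (n + 2) = [] := by
  induction n with
  | zero => simp [Cl, phi, phiUp, numActive_eq_zero h, Lseq]
  | succ n ih => rw [Cl, ih, List.flatMap_nil]

theorem Regular.mem_Cl {T : Set (List ℕ)} (hT : Regular T) (h1 : AvoidsAll T [1]) (n : ℕ) :
    ∀ p ∈ Cl T (n + 1), IsPermOf (n + 1) p.1 ∧ AvoidsAll T p.1 := by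
  induction n with
  | zero => simpa [Cl, IsPermOf] using h1
  | succ n ih =>
    intro x hx
    rw [Cl, List.mem_flatMap] at hx
    obtain ⟨p, hp, hx⟩ := hx
    obtain ⟨i, hi, hix⟩ := fst_eq_of_mem_phi hx
    obtain ⟨hperm, havoid⟩ := ih p hp
    have hi := mem_Lseq hi
    rw [← hix]
    exact ⟨hperm.insertSite i, (hT.activeSite n.succ_pos hperm havoid hi.1 hi.2).2.2⟩

theorem Regular.isChain_Cl {T : Set (List ℕ)} (hT : Regular T) (h1 : AvoidsAll T [1]) (n : ℕ) :
    (Cl T (n + 1)).IsChain Close := by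
  induction n with
  | zero => simp [Cl]
  | succ n ih =>
    have hmem := hT.mem_Cl h1 n
    have hact : ∀ p ∈ Cl T (n + 1), 2 ≤ numActive T p.1 := fun p hp =>
      (hT.1 _ n.succ_pos p.1 (hmem p hp).1 (hmem p hp).2).1
    rw [Cl, List.flatMap_def, List.isChain_flatten, List.isChain_map]
    · refine ⟨?_, ih.imp_of_mem_imp fun p q hp hq hpq => ?_⟩
      · simp only [List.mem_map]
        rintro _ ⟨p, -, rfl⟩
        exact (isChain_phi T p).imp fun x y => Or.inl
      · exact hpq.ends ((hmem p hp).1.length_eq.trans (hmem q hq).1.length_eq.symm)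
          (hact p hp) (hact q hq)
    · simp only [List.mem_map, not_exists, not_and]
      intro p hp hnil
      simpa [hnil] using (phi_ends (hact p hp)).1

/-- For a regular set of patterns `T`, any two consecutive permutations in the list
`𝒞_n(T)` differ in at most five positions. -/
theorem Cl_consecutive_ddist_le_five (T : Set (List ℕ)) (hT : Regular T) :
    ∀ n : ℕ, 1 ≤ n → ∀ q : ℕ, q + 1 < (Cl T n).length →
      ddist ((Cl T n).getD q ([], true)).1 ((Cl T n).getD (q + 1) ([], true)).1 ≤ 5 := by
  intro n hn q hq
  obtain _ | _ | n := n
  · omega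
  · simp [Cl] at hq
  by_cases h1 : AvoidsAll T [1]
  · have h := List.isChain_iff_getElem.1 (hT.isChain_Cl h1 (n + 1)) q hq
    rw [List.getD_eq_getElem _ _ (by omega), List.getD_eq_getElem _ _ hq]
    obtain h | h := h
    · omega
    · exact h.1
  · simp [Cl_eq_nil h1] at hq
end
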